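/- Let p be an odd prime and n a positive integer not divisible by p, and let K be the unramified extension of ℚ_p of degree n. The map r : K* → ℚ_p^{(1)}, x ↦ (N(ω(x)^{−1}x))^{1/n}, is a surjective group homomorphism satisfying r(λ) = λ for every λ ∈ ℚ_p^{(1)} and |r(x)|_p^n = ‖x‖ for every x ∈ K*. -/

import Mathlib

open scoped Classical
noncomputable section

/-- The group `1 + pℤ_p` of principal units of `ℚ_p`. -/
def PUnits1 (p : ℕ) [Fact (Nat.Prime p)] : Set ℚ_[p] :=
  {u : ℚ_[p] | ‖u - 1‖ ≤ (p : ℝ)⁻¹}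

/-- The multiplicative subgroup `ℚ_p^{(1)} = p^ℤ · (1 + pℤ_p)` of `ℚ_p^*`. -/
def Qp1 (p : ℕ) [Fact (Nat.Prime p)] : Set ℚ_[p] :=
  {z : ℚ_[p] | ∃ ν : ℤ, ∃ u ∈ PUnits1 p, z = (p : ℚ_[p]) ^ ν * u}

/-- `ℚ_p^{(+)} = ℚ_p^{(1)} ∪ {0}`. -/
def QpPlus (p : ℕ) [Fact (Nat.Prime p)] : Set ℚ_[p] := Qp1 p ∪ {0}

/-- The ring of integers `O` of a normed field, i.e. the closed unit ball. -/
def ringO (K : Type) [NormedField K] : Set K := {x : K | ‖x‖ ≤ 1}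

/-- The group `U₁ = 1 + pO` of principal units of `K`. -/
def U1 (p : ℕ) (K : Type) [NormedField K] : Set K :=
  {x : K | ∃ y ∈ ringO K, x = 1 + (p : K) * y}

/-- The group `μ_{q-1}` of `(q-1)`-st roots of unity of `K`. -/
def muRoots (q : ℕ) (K : Type) [NormedField K] : Set K := {x : K | x ^ (q - 1) = 1}

/-- `ω : K → K` is a Teichmüller-component map: every `x ∈ K*` is uniquely
`x = p^ν · ω(x) · u` with `ω(x) ∈ μ_{q-1}` and `u ∈ U₁`. -/
def IsTeich (p q : ℕ) (K : Type) [NormedField K] (ω : K → K) : Prop :=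
  ∀ x : K, x ≠ 0 →
    (ω x ∈ muRoots q K ∧ ∃ ν : ℤ, ∃ u ∈ U1 p K, x = (p : K) ^ ν * (ω x * u)) ∧
    ∀ (w : K) (ν : ℤ) (u : K), w ∈ muRoots q K → u ∈ U1 p K →
      x = (p : K) ^ ν * (w * u) → w = ω x

/-- The compact group `Σ_n = {y ∈ K* : ω(y) = 1, N(y) = 1}`. -/
def SigmaN (p : ℕ) [Fact (Nat.Prime p)] (K : Type) [NormedField K] [Algebra ℚ_[p] K]
    (ω : K → K) : Set K :=
  {y : K | y ≠ 0 ∧ ω y = 1 ∧ Algebra.norm ℚ_[p] y = 1}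

/-- `r : K* → ℚ_p^{(1)}`, `r(x) = (N(ω(x)⁻¹ x))^{1/n}`, the radial part of the
spherical coordinates (characterized by `r(x) ∈ ℚ_p^{(1)}` and `r(x)^n = N(ω(x)⁻¹ x)`,
which determines it uniquely since `p ∤ n`). -/
def IsRadial (p n : ℕ) [Fact (Nat.Prime p)] (K : Type) [NormedField K] [Algebra ℚ_[p] K]
    (ω : K → K) (r : K → ℚ_[p]) : Prop :=
  ∀ x : K, x ≠ 0 → r x ∈ Qp1 p ∧ (r x) ^ n = Algebra.norm ℚ_[p] ((ω x)⁻¹ * x)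

/-- `K` is the unramified extension of `ℚ_p` of degree `n`: it has degree `n`,
its norm is the normalized absolute value `‖x‖ = |N(x)|_p`, and its value group
is `q^ℤ`, `q = p^n` (i.e. the extension is unramified). -/
def IsUnramifiedDeg (p n : ℕ) [Fact (Nat.Prime p)] (K : Type) [NormedField K]
    [Algebra ℚ_[p] K] : Prop :=
  Module.finrank ℚ_[p] K = n ∧
  (∀ x : K, ‖x‖ = ‖Algebra.norm ℚ_[p] x‖) ∧
  (∀ x : K, x ≠ 0 → ∃ m : ℤ, ‖x‖ = (p : ℝ) ^ ((n : ℤ) * m))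

theorem one_mem_PUnits1 (p : ℕ) [Fact (Nat.Prime p)] : (1 : ℚ_[p]) ∈ PUnits1 p := by
  simp [PUnits1]

theorem inv_natCast_prime_lt_one (p : ℕ) [hp : Fact (Nat.Prime p)] : (p : ℝ)⁻¹ < 1 :=
  inv_lt_one_of_one_lt₀ (by exact_mod_cast hp.out.one_lt)

theorem norm_eq_one_of_mem_PUnits1 {p : ℕ} [Fact (Nat.Prime p)] {u : ℚ_[p]}
    (hu : u ∈ PUnits1 p) : ‖u‖ = 1 := by
  have h : ‖u - 1‖ < ‖(1 : ℚ_[p])‖ := by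
    rw [norm_one]
    exact lt_of_le_of_lt hu (inv_natCast_prime_lt_one p)
  have := IsUltrametricDist.norm_add_eq_max_of_norm_ne_norm h.ne
  rw [sub_add_cancel, max_eq_right h.le, norm_one] at this
  exact this

theorem mul_mem_PUnits1 {p : ℕ} [Fact (Nat.Prime p)] {u v : ℚ_[p]}
    (hu : u ∈ PUnits1 p) (hv : v ∈ PUnits1 p) : u * v ∈ PUnits1 p := by
  have h : u * v - 1 = u * (v - 1) + (u - 1) := by ring
  change ‖u * v - 1‖ ≤ _
  rw [h]
  refine (IsUltrametricDist.norm_add_le_max _ _).trans (max_le ?_ hu)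
  rw [norm_mul, norm_eq_one_of_mem_PUnits1 hu, one_mul]
  exact hv

theorem pow_mem_PUnits1 {p : ℕ} [Fact (Nat.Prime p)] {u : ℚ_[p]}
    (hu : u ∈ PUnits1 p) (k : ℕ) : u ^ k ∈ PUnits1 p := by
  induction k with
  | zero => simpa using one_mem_PUnits1 p
  | succ k ih => rw [pow_succ]; exact mul_mem_PUnits1 ih hu

theorem ne_zero_of_mem_PUnits1 {p : ℕ} [Fact (Nat.Prime p)] {u : ℚ_[p]}
    (hu : u ∈ PUnits1 p) : u ≠ 0 := by
  rw [← norm_ne_zero_iff, norm_eq_one_of_mem_PUnits1 hu]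
  exact one_ne_zero

theorem div_mem_PUnits1 {p : ℕ} [Fact (Nat.Prime p)] {u v : ℚ_[p]}
    (hu : u ∈ PUnits1 p) (hv : v ∈ PUnits1 p) : u / v ∈ PUnits1 p := by
  have hv0 := ne_zero_of_mem_PUnits1 hv
  have h : u / v - 1 = ((u - 1) - (v - 1)) / v := by field_simp; ring
  change ‖u / v - 1‖ ≤ _
  rw [h, norm_div, norm_eq_one_of_mem_PUnits1 hv, div_one]
  rw [sub_eq_add_neg]
  refine (IsUltrametricDist.norm_add_le_max _ _).trans (max_le hu ?_)
  rw [norm_neg]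
  exact hv

/-- The principal units of `ℚ_p` contain no nontrivial roots of unity of order prime to `p`. -/
theorem eq_one_of_mem_PUnits1_of_pow_eq_one {p n : ℕ} [Fact (Nat.Prime p)] (hpn : ¬ p ∣ n)
    {w : ℚ_[p]} (hw : w ∈ PUnits1 p) (h : w ^ n = 1) : w = 1 := by
  have hmul : (∑ i ∈ Finset.range n, w ^ i) * (w - 1) = 0 := by
    rw [geom_sum_mul, h, sub_self]
  rcases mul_eq_zero.mp hmul with h0 | h1
  · exfalso
    have hsum : ∑ i ∈ Finset.range n, (w ^ i - 1) = -(n : ℚ_[p]) := by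
      rw [Finset.sum_sub_distrib, h0]
      simp
    have hle : ‖∑ i ∈ Finset.range n, (w ^ i - 1)‖ ≤ (p : ℝ)⁻¹ :=
      IsUltrametricDist.norm_sum_le_of_forall_le_of_nonneg (by positivity)
        fun i _ => pow_mem_PUnits1 hw i
    rw [hsum, norm_neg] at hle
    exact hpn (Padic.norm_natCast_lt_one_iff.mp
      (hle.trans_lt (inv_natCast_prime_lt_one p)))
  · exact sub_eq_zero.mp h1

theorem mul_mem_Qp1 {p : ℕ} [hp : Fact (Nat.Prime p)] {a b : ℚ_[p]}
    (ha : a ∈ Qp1 p) (hb : b ∈ Qp1 p) : a * b ∈ Qp1 p := by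
  obtain ⟨ν, u, hu, rfl⟩ := ha
  obtain ⟨μ, v, hv, rfl⟩ := hb
  have hp0 : (p : ℚ_[p]) ≠ 0 := by exact_mod_cast hp.out.ne_zero
  exact ⟨ν + μ, u * v, mul_mem_PUnits1 hu hv, by rw [zpow_add₀ hp0]; ring⟩

theorem ne_zero_of_mem_Qp1 {p : ℕ} [hp : Fact (Nat.Prime p)] {a : ℚ_[p]}
    (ha : a ∈ Qp1 p) : a ≠ 0 := by
  obtain ⟨ν, u, hu, rfl⟩ := ha
  have hp0 : (p : ℚ_[p]) ≠ 0 := by exact_mod_cast hp.out.ne_zero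
  exact mul_ne_zero (zpow_ne_zero _ hp0) (ne_zero_of_mem_PUnits1 hu)

/-- Uniqueness of `n`-th roots in `ℚ_p^{(1)}` for `n` prime to `p`. -/
theorem eq_of_mem_Qp1_of_pow_eq {p n : ℕ} [hp : Fact (Nat.Prime p)] (hn : n ≠ 0)
    (hpn : ¬ p ∣ n) {a b : ℚ_[p]} (ha : a ∈ Qp1 p) (hb : b ∈ Qp1 p) (h : a ^ n = b ^ n) :
    a = b := by
  have hnorm : ‖a‖ = ‖b‖ := by
    rw [← pow_left_inj₀ (norm_nonneg a) (norm_nonneg b) hn, ← norm_pow, ← norm_pow, h]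
  obtain ⟨ν, u, hu, rfl⟩ := ha
  obtain ⟨μ, v, hv, rfl⟩ := hb
  have hp0 : (p : ℚ_[p]) ≠ 0 := by exact_mod_cast hp.out.ne_zero
  have hνμ : ν = μ := by
    rw [norm_mul, norm_mul, norm_eq_one_of_mem_PUnits1 hu, norm_eq_one_of_mem_PUnits1 hv,
      mul_one, mul_one, Padic.norm_p_zpow, Padic.norm_p_zpow] at hnorm
    have := zpow_right_injective₀ (a := (p : ℝ)) (by exact_mod_cast hp.out.pos)
      (by exact_mod_cast hp.out.one_lt.ne') hnorm
    exact neg_injective this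
  subst hνμ
  rw [mul_pow, mul_pow] at h
  have huv : u ^ n = v ^ n := mul_left_cancel₀ (pow_ne_zero _ (zpow_ne_zero _ hp0)) h
  have hv0 := ne_zero_of_mem_PUnits1 hv
  have hw : u / v = 1 := eq_one_of_mem_PUnits1_of_pow_eq_one hpn (div_mem_PUnits1 hu hv) (by
    rw [div_pow, huv, div_self (pow_ne_zero _ hv0)])
  rw [(div_eq_one_iff_eq hv0).mp hw]

section Unramified

variable {p n q : ℕ} [Fact (Nat.Prime p)] {K : Type} [NormedField K] [Algebra ℚ_[p] K]

theorem IsUnramifiedDeg.norm_algebraMap (hK : IsUnramifiedDeg p n K) (z : ℚ_[p]) :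
    ‖algebraMap ℚ_[p] K z‖ = ‖z‖ ^ n := by
  rw [hK.2.1, Algebra.norm_algebraMap, hK.1, norm_pow]

theorem IsUnramifiedDeg.norm_natCast_le_one (hK : IsUnramifiedDeg p n K) (m : ℕ) :
    ‖(m : K)‖ ≤ 1 := by
  rw [← map_natCast (algebraMap ℚ_[p] K), hK.norm_algebraMap]
  exact pow_le_one₀ (norm_nonneg _) (by simpa using Padic.norm_int_le_one (p := p) m)

theorem IsUnramifiedDeg.isUltrametricDist (hK : IsUnramifiedDeg p n K) : IsUltrametricDist K :=
  IsUltrametricDist.isUltrametricDist_of_forall_norm_natCast_le_one hK.norm_natCast_le_one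

theorem IsUnramifiedDeg.mul_mem_U1 (hK : IsUnramifiedDeg p n K) {u v : K}
    (hu : u ∈ U1 p K) (hv : v ∈ U1 p K) : u * v ∈ U1 p K := by
  have := hK.isUltrametricDist
  obtain ⟨a, ha, rfl⟩ := hu
  obtain ⟨b, hb, rfl⟩ := hv
  simp only [ringO, Set.mem_ofPred_eq] at ha hb
  refine ⟨a + b + p * (a * b), ?_, by ring⟩
  change ‖a + b + p * (a * b)‖ ≤ 1
  refine (IsUltrametricDist.norm_add_le_max _ _).trans (max_le
    ((IsUltrametricDist.norm_add_le_max _ _).trans (max_le ha hb)) ?_)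
  rw [norm_mul, norm_mul]
  exact mul_le_one₀ (hK.norm_natCast_le_one p) (by positivity)
    (mul_le_one₀ ha (norm_nonneg _) hb)

theorem IsUnramifiedDeg.algebraMap_mem_U1 (hK : IsUnramifiedDeg p n K) {u : ℚ_[p]}
    (hu : u ∈ PUnits1 p) : algebraMap ℚ_[p] K u ∈ U1 p K := by
  have hp : Nat.Prime p := Fact.out
  have hp0 : (p : ℚ_[p]) ≠ 0 := by exact_mod_cast hp.ne_zero
  refine ⟨algebraMap ℚ_[p] K ((u - 1) / p), ?_, ?_⟩
  · change ‖_‖ ≤ 1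
    rw [hK.norm_algebraMap]
    refine pow_le_one₀ (norm_nonneg _) ?_
    rw [norm_div, Padic.norm_p]
    exact div_le_one_of_le₀ hu (by positivity)
  · rw [← map_natCast (algebraMap ℚ_[p] K), ← map_mul, mul_div_cancel₀ _ hp0, map_sub, map_one]
    ring

theorem IsTeich.map_mul {ω : K → K} (hK : IsUnramifiedDeg p n K) (hω : IsTeich p q K ω)
    {x y : K} (hx : x ≠ 0) (hy : y ≠ 0) : ω (x * y) = ω x * ω y := by
  have hp : Nat.Prime p := Fact.out
  have hp0 : (p : K) ≠ 0 := by
    rw [← map_natCast (algebraMap ℚ_[p] K), map_ne_zero]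
    exact_mod_cast hp.ne_zero
  obtain ⟨hωx, ν, u, hu, hxu⟩ := (hω x hx).1
  obtain ⟨hωy, μ, v, hv, hyv⟩ := (hω y hy).1
  refine ((hω (x * y) (mul_ne_zero hx hy)).2 (ω x * ω y) (ν + μ) (u * v) ?_
    (hK.mul_mem_U1 hu hv) ?_).symm
  · simp only [muRoots, Set.mem_ofPred_eq] at hωx hωy ⊢
    rw [mul_pow, hωx, hωy, one_mul]
  · calc x * y = ((p : K) ^ ν * (ω x * u)) * ((p : K) ^ μ * (ω y * v)) := by rw [← hxu, ← hyv]
      _ = (p : K) ^ (ν + μ) * (ω x * ω y * (u * v)) := by rw [zpow_add₀ hp0]; ring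

theorem IsTeich.algebraMap_eq_one {ω : K → K} (hK : IsUnramifiedDeg p n K)
    (hω : IsTeich p q K ω) {z : ℚ_[p]} (hz : z ∈ Qp1 p) : ω (algebraMap ℚ_[p] K z) = 1 := by
  have hz0 : algebraMap ℚ_[p] K z ≠ 0 := (map_ne_zero _).mpr (ne_zero_of_mem_Qp1 hz)
  obtain ⟨ν, u, hu, hzu⟩ := hz
  refine ((hω _ hz0).2 1 ν (algebraMap ℚ_[p] K u) (one_pow _) (hK.algebraMap_mem_U1 hu) ?_).symm
  rw [hzu, _root_.map_mul, map_zpow₀, map_natCast, one_mul]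

end Unramified

/-- The map `r : K* → ℚ_p^{(1)}`, `x ↦ (N(ω(x)⁻¹x))^{1/n}`, is a surjective
group homomorphism with `r(λ) = λ` for `λ ∈ ℚ_p^{(1)}` and `|r(x)|_p^n = ‖x‖` for `x ∈ K*`. -/
theorem radial_map_hom_surjective
    (p n q : ℕ) [Fact (Nat.Prime p)] (hp2 : p ≠ 2) (hn : 0 < n) (hpn : ¬ p ∣ n)
    (hq : q = p ^ n)
    (K : Type) [NormedField K] [Algebra ℚ_[p] K] [FiniteDimensional ℚ_[p] K]
    (hK : IsUnramifiedDeg p n K)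
    (ω : K → K) (hω : IsTeich p q K ω)
    (r : K → ℚ_[p]) (hr : IsRadial p n K ω r) :
    (∀ x y : K, x ≠ 0 → y ≠ 0 → r (x * y) = r x * r y) ∧
    (∀ ρ ∈ Qp1 p, ∃ x : K, x ≠ 0 ∧ r x = ρ) ∧
    (∀ lam ∈ Qp1 p, r (algebraMap ℚ_[p] K lam) = lam) ∧
    (∀ x : K, x ≠ 0 → ‖r x‖ ^ n = ‖x‖) := by
  have hn0 : n ≠ 0 := hn.ne'
  have hmap : ∀ lam ∈ Qp1 p, r (algebraMap ℚ_[p] K lam) = lam := by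
    intro lam hlam
    have hr' := hr (algebraMap ℚ_[p] K lam) ((map_ne_zero _).mpr (ne_zero_of_mem_Qp1 hlam))
    refine eq_of_mem_Qp1_of_pow_eq hn0 hpn hr'.1 hlam ?_
    rw [hr'.2, hω.algebraMap_eq_one hK hlam, inv_one, one_mul, Algebra.norm_algebraMap, hK.1]
  refine ⟨fun x y hx hy => ?_, fun ρ hρ => ⟨algebraMap ℚ_[p] K ρ,
    (map_ne_zero _).mpr (ne_zero_of_mem_Qp1 hρ), hmap ρ hρ⟩, hmap, fun x hx => ?_⟩
  · have hrxy := hr (x * y) (mul_ne_zero hx hy)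
    refine eq_of_mem_Qp1_of_pow_eq hn0 hpn hrxy.1 (mul_mem_Qp1 (hr x hx).1 (hr y hy).1) ?_
    rw [hrxy.2, mul_pow, (hr x hx).2, (hr y hy).2, ← map_mul, hω.map_mul hK hx hy, mul_inv]
    congr 1
    ring
  · have hq1 : q - 1 ≠ 0 := by
      have := Nat.one_lt_pow hn0 (Fact.out : Nat.Prime p).one_lt
      omega
    have hωx : ω x ^ (q - 1) = 1 := (hω x hx).1.1
    have hωnorm : ‖ω x‖ = 1 := by
      rw [← pow_eq_one_iff_of_nonneg (norm_nonneg _) hq1, ← norm_pow, hωx, norm_one]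
    rw [← norm_pow, (hr x hx).2, ← hK.2.1, norm_mul, norm_inv, hωnorm, inv_one, one_mul]
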